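/- Let u : ω^ω → ω^ω be a continuous map such that for every sequence (γ_i)_{i∈ℕ} ∈ 𝔸_ω, the sequence (u(γ_i))_{i∈ℕ} belongs to 𝔸_ω. Then there exist α ∈ ω^ω and a sequence (t_n)_{n∈ℕ} of finite sequences of natural numbers such that for every β ∈ ω^ω, u(β(0)⌢0^{α(0)}⌢β(1)⌢0^{α(1)}⌢⋯) = t_0⌢β(0)⌢t_1⌢β(1)⌢⋯, where 0^k denotes the constant-0 sequence of length k and the expressions denote the infinite concatenations. -/

import Mathlib

open Set

/-- Concatenation `s ⌢ γ` of a finite sequence with an infinite sequence. -/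
def cat {α : Type*} (s : List α) (γ : ℕ → α) : ℕ → α :=
  fun k => if h : k < s.length then s.get ⟨k, h⟩ else γ (k - s.length)

/-- The set `𝔸_ω ⊆ (ω^ω)^ω` associated with the dense sequence `s`. -/
def Aomega (s : ℕ → List ℕ) : Set (ℕ → ℕ → ℕ) :=
  {x | ∃ n γ, ∀ i, x i = cat (s n ++ [i]) γ}

/-- Concatenation of the first `k` blocks of a sequence of finite blocks. -/
def pcat (B : ℕ → List ℕ) : ℕ → List ℕ
  | 0 => []
  | k + 1 => pcat B k ++ B k

/-- The infinite concatenation of a sequence of (nonempty) finite blocks. -/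
def flatten (B : ℕ → List ℕ) : ℕ → ℕ :=
  fun n => (pcat B (n + 1)).getD n 0

theorem cat_apply_lt {α : Type*} {s : List α} (γ : ℕ → α) {k : ℕ} (h : k < s.length) :
    cat s γ k = s[k] := by
  simp [cat, h]

theorem cat_apply_ge {α : Type*} {s : List α} (γ : ℕ → α) {k : ℕ} (h : s.length ≤ k) :
    cat s γ k = γ (k - s.length) := by
  simp [cat, Nat.not_lt.2 h]

theorem cat_nil {α : Type*} (γ : ℕ → α) : cat [] γ = γ := by
  funext k
  simp [cat]

theorem cat_append {α : Type*} (s t : List α) (γ : ℕ → α) :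
    cat (s ++ t) γ = cat s (cat t γ) := by
  funext k
  simp only [cat, List.length_append, List.get_eq_getElem, List.getElem_append]
  split_ifs <;> first | rfl | omega | (congr 1; omega)

theorem eq_cat_drop_of_cat_eq_cat {α : Type*} {s t : List α} {γ δ : ℕ → α}
    (h : cat s γ = cat t δ) (hst : s.length ≤ t.length) : γ = cat (t.drop s.length) δ := by
  funext k
  have hk := congrFun h (s.length + k)
  rw [cat_apply_ge _ (Nat.le_add_right _ _), Nat.add_sub_cancel_left] at hk
  rw [hk]
  simp only [cat, List.length_drop, List.get_eq_getElem, List.getElem_drop]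
  split_ifs <;> first | rfl | omega | (congr 1; omega)

theorem cat_append_singleton_apply_length {α : Type*} (s : List α) (i : α) (γ : ℕ → α) :
    cat (s ++ [i]) γ s.length = i := by
  simp [cat]

theorem cat_append_apply_of_lt {α : Type*} (s t : List α) (γ : ℕ → α) {k : ℕ}
    (h : k < s.length) : cat (s ++ t) γ k = s[k] := by
  rw [cat_append, cat_apply_lt _ h]

theorem continuous_cat {α : Type*} [TopologicalSpace α] (s : List α) : Continuous (cat s) := by
  refine continuous_pi fun k => ?_
  by_cases h : k < s.length
  · simpa only [cat, h, dite_true] using continuous_const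
  · simpa only [cat, h, dite_false] using continuous_apply _

theorem exists_zero_cylinder_subset {U : Set (ℕ → ℕ)} (hU : U ∈ nhds (0 : ℕ → ℕ)) :
    ∃ a, ∀ b ≥ a, ∀ γ, cat (List.replicate b 0) γ ∈ U := by
  obtain ⟨V, hVU, hV, h0⟩ := mem_nhds_iff.1 hU
  obtain ⟨I, v, hv, hI⟩ := isOpen_pi_iff.1 hV 0 h0
  refine ⟨I.sup id + 1, fun b hb γ => hVU (hI fun i hi => ?_)⟩
  have hib : i < b := lt_of_le_of_lt (Finset.le_sup (f := id) hi) hb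
  rw [cat_apply_lt _ (by simpa using hib), List.getElem_replicate]
  exact (hv i hi).2

theorem length_le_length_pcat {B : ℕ → List ℕ} (hB : ∀ k, B k ≠ []) (k : ℕ) :
    k ≤ (pcat B k).length := by
  induction k with
  | zero => exact Nat.zero_le _
  | succ k ih =>
    have := List.length_pos_iff.2 (hB k)
    simp only [pcat, List.length_append]
    omega

theorem pcat_isPrefix_of_le (B : ℕ → List ℕ) {k l : ℕ} (h : k ≤ l) : pcat B k <+: pcat B l := by
  induction l, h using Nat.le_induction with
  | base => exact List.prefix_refl _
  | succ l _ ih => exact ih.trans (List.prefix_append _ _)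

theorem flatten_apply_of_lt {B : ℕ → List ℕ} (hB : ∀ k, B k ≠ []) {k n : ℕ}
    (h : n < (pcat B k).length) : flatten B n = (pcat B k)[n] := by
  have hn : n < (pcat B (n + 1)).length := length_le_length_pcat hB (n + 1)
  rw [flatten, List.getD_eq_getElem _ _ hn]
  rcases le_total k (n + 1) with hk | hk
  · exact ((pcat_isPrefix_of_le B hk).getElem h).symm
  · exact (pcat_isPrefix_of_le B hk).getElem hn

theorem flatten_eq_cat_pcat {B : ℕ → List ℕ} (hB : ∀ k, B k ≠ []) (k : ℕ) :
    flatten B = cat (pcat B k) fun j => flatten B (j + (pcat B k).length) := by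
  funext n
  rcases lt_or_ge n (pcat B k).length with h | h
  · rw [cat_apply_lt _ h, flatten_apply_of_lt hB h]
  · rw [cat_apply_ge _ h, Nat.sub_add_cancel h]

/-- `D` describes the values of `u` on the sequences extending `0ⁿ = s n`, after removal of a
common prefix. -/
def IsTailAt (s : ℕ → List ℕ) (u : (ℕ → ℕ) → ℕ → ℕ) (n : ℕ) (D : (ℕ → ℕ) → ℕ → ℕ) : Prop :=
  s n = List.replicate n 0 ∧ ∃ w, ∀ γ, u (cat (List.replicate n 0) γ) = cat w (D γ)

/-- The position at which a sequence in `Aomega s` branches is locally constant along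
continuous families. -/
theorem exists_branching_position_constant {s : ℕ → List ℕ} (hlen : ∀ n, (s n).length = n)
    {F : ℕ → (ℕ → ℕ) → ℕ → ℕ} (hF : ∀ i, Continuous (F i))
    (hA : ∀ γ, (fun i => F i γ) ∈ Aomega s) :
    ∃ m a, ∀ b ≥ a, ∀ γ, ∃ δ, ∀ i,
      F i (cat (List.replicate b 0) γ) = cat (s m ++ [i]) δ := by
  choose m δ hm using hA
  have below : ∀ γ i j k, k < m γ → F i γ k = F j γ k := fun γ i j k hk => by
    have hk' : k < (s (m γ)).length := by rwa [hlen]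
    have hi := congrFun (hm γ i) k
    have hj := congrFun (hm γ j) k
    rw [cat_append_apply_of_lt _ _ _ hk'] at hi hj
    exact hi.trans hj.symm
  have branch : ∀ γ i, F i γ (m γ) = i := fun γ i => by
    have hi := congrFun (hm γ i) (m γ)
    have hc := cat_append_singleton_apply_length (s (m γ)) i (δ γ)
    rw [hlen] at hc
    exact hi.trans hc
  have hU : {γ | ∀ k ≤ m 0, ∀ i ≤ 1, F i γ k = F i 0 k} ∈ nhds (0 : ℕ → ℕ) := by
    refine (Filter.eventually_all_finite (Set.finite_Iic (m 0))).2 fun k _ =>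
      (Filter.eventually_all_finite (Set.finite_Iic 1)).2 fun i _ => ?_
    have hc : Continuous fun γ => F i γ k := (continuous_apply k).comp (hF i)
    exact hc.continuousAt.eventually ((isOpen_discrete {F i 0 k}).mem_nhds rfl)
  obtain ⟨a, ha⟩ := exists_zero_cylinder_subset hU
  refine ⟨m 0, a, fun b hb γ => ⟨δ (cat (List.replicate b 0) γ), fun i => ?_⟩⟩
  have hγ := ha b hb γ
  generalize cat (List.replicate b 0) γ = x at hγ ⊢
  have hmx : m x = m 0 := by
    rcases lt_trichotomy (m x) (m 0) with h | h | h
    · have h0 := hγ (m x) h.le 0 zero_le_one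
      have h1 := hγ (m x) h.le 1 le_rfl
      rw [branch] at h0 h1
      have := below 0 0 1 _ h
      omega
    · exact h
    · have h0 := hγ (m 0) le_rfl 0 zero_le_one
      have h1 := hγ (m 0) le_rfl 1 le_rfl
      rw [branch] at h0 h1
      have := below x 0 1 _ h
      omega
  exact hmx ▸ hm x i

theorem IsTailAt.exists_next {s : ℕ → List ℕ} (hlen : ∀ n, (s n).length = n)
    (hzero : ∀ m, ∃ n ≥ m, s n = List.replicate n 0) {u : (ℕ → ℕ) → ℕ → ℕ} (hu : Continuous u)
    (hhom : ∀ γ ∈ Aomega s, (fun i => u (γ i)) ∈ Aomega s) {n : ℕ} {D : (ℕ → ℕ) → ℕ → ℕ}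
    (h : IsTailAt s u n D) :
    ∃ a t D', IsTailAt s u (n + (a + 1)) D' ∧
      ∀ i γ, D (cat (i :: List.replicate a 0) γ) = cat (t ++ [i]) (D' γ) := by
  obtain ⟨hs, w, hw⟩ := h
  obtain ⟨m, a₀, ha₀⟩ := exists_branching_position_constant hlen
    (F := fun i γ => u (cat (s n ++ [i]) γ)) (fun i => hu.comp (continuous_cat _))
    (fun γ => hhom _ ⟨n, γ, fun _ => rfl⟩)
  obtain ⟨N, hN, hsN⟩ := hzero (n + (a₀ + 1))
  obtain ⟨a, rfl⟩ : ∃ a, N = n + (a + 1) := ⟨N - n - 1, by omega⟩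
  choose D' hD' using ha₀ a (by omega)
  have key : ∀ i γ, cat w (D (cat (i :: List.replicate a 0) γ)) = cat (s m ++ [i]) (D' γ) := by
    intro i γ
    rw [← hD' γ i, ← hw, hs, cat_append, ← cat_append [i]]
    rfl
  have hwm : w.length ≤ m := by
    by_contra! hlt
    have h0 := congrFun (key 0 0) (s m).length
    have h1 := congrFun (key 1 0) (s m).length
    rw [cat_append_singleton_apply_length, cat_apply_lt _ (by rwa [hlen])] at h0 h1
    omega
  have hD : ∀ i γ, D (cat (i :: List.replicate a 0) γ) =
      cat ((s m).drop w.length ++ [i]) (D' γ) := by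
    intro i γ
    rw [← List.drop_append_of_le_length (by rwa [hlen])]
    exact eq_cat_drop_of_cat_eq_cat (key i γ) (by rw [List.length_append, hlen]; omega)
  refine ⟨a, (s m).drop w.length, D', ⟨hsN, w ++ ((s m).drop w.length ++ [0]), fun γ => ?_⟩, hD⟩
  rw [List.replicate_add, cat_append, hw, List.replicate_succ, hD, ← cat_append]

theorem stmt14 (s : ℕ → List ℕ)
    (hlen : ∀ n, (s n).length = n)
    (hdense : ∀ t : List ℕ, ∃ n, t <+: s n)
    (hzero : ∀ m, ∃ n ≥ m, s n = List.replicate n 0)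
    (u : (ℕ → ℕ) → (ℕ → ℕ)) (hu : Continuous u)
    (hhom : ∀ γ ∈ Aomega s, (fun i => u (γ i)) ∈ Aomega s) :
    ∃ α : ℕ → ℕ, ∃ t : ℕ → List ℕ, ∀ β : ℕ → ℕ,
      u (flatten (fun k => β k :: List.replicate (α k) 0)) =
        flatten (fun k => t k ++ [β k]) := by
  let S := {p : ℕ × ((ℕ → ℕ) → ℕ → ℕ) // IsTailAt s u p.1 p.2}
  have step : ∀ p : S, ∃ (a : ℕ) (t : List ℕ) (q : S), ∀ i γ,
      p.1.2 (cat (i :: List.replicate a 0) γ) = cat (t ++ [i]) (q.1.2 γ) := by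
    intro p
    obtain ⟨a, t, D', hD', h⟩ := p.2.exists_next hlen hzero hu hhom
    exact ⟨a, t, ⟨(_, D'), hD'⟩, h⟩
  choose a t q hq using step
  have h0 : IsTailAt s u 0 u :=
    ⟨List.eq_nil_of_length_eq_zero (hlen 0), [], fun γ => by
      rw [List.replicate_zero, cat_nil, cat_nil]⟩
  let p : ℕ → S := fun k => q^[k] ⟨(0, u), h0⟩
  refine ⟨fun k => a (p k), fun k => t (p k), fun β => ?_⟩
  set A : ℕ → List ℕ := fun k => β k :: List.replicate (a (p k)) 0
  set T : ℕ → List ℕ := fun k => t (p k) ++ [β k]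
  have hA : ∀ k, A k ≠ [] := fun k => List.cons_ne_nil _ _
  have hT : ∀ k, T k ≠ [] := fun k => by simp [T]
  have main : ∀ k γ, u (cat (pcat A k) γ) = cat (pcat T k) ((p k).1.2 γ) := by
    intro k
    induction k with
    | zero => intro γ; simp only [pcat, cat_nil]; rfl
    | succ k ih =>
      intro γ
      have hp : p (k + 1) = q (p k) := Function.iterate_succ_apply' _ _ _
      simp only [pcat]
      rw [cat_append, ih, hq, ← cat_append, hp]
  funext n
  have hn : n < (pcat T (n + 1)).length := length_le_length_pcat hT (n + 1)
  rw [flatten_eq_cat_pcat hA (n + 1), main, cat_apply_lt _ hn, flatten_apply_of_lt hT hn]
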